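/- Let τ be an ℵ₀-tangle of G and X a finite set of vertices such that U(τ,X) is non-principal. Then τ = {(A',B') ∈ S⃗ : there exists 𝒞 ∈ U(τ,X) with ⋃𝒞 ⊆ B'}. -/

import Mathlib

open Set

variable {V : Type*}

/-- `{A,B}` is a separation of `G`: `A ∪ B = V` and no edge between `A∖B` and `B∖A`. -/
def IsSep (G : SimpleGraph V) (A B : Set V) : Prop :=
  A ∪ B = Set.univ ∧ ∀ a ∈ A \ B, ∀ b ∈ B \ A, ¬ G.Adj a b

/-- A separation of finite order. -/
def IsFinSep (G : SimpleGraph V) (A B : Set V) : Prop :=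
  IsSep G A B ∧ (A ∩ B).Finite

/-- The set `S⃗` of oriented finite-order separations of `G`, as ordered pairs. -/
def Svec (G : SimpleGraph V) : Set (Set V × Set V) :=
  {p | IsFinSep G p.1 p.2}

/-- `(A,B) ≤ (C,D)` iff `A ⊆ C` and `D ⊆ B`. -/
def sepLE (p q : Set V × Set V) : Prop :=
  p.1 ⊆ q.1 ∧ q.2 ⊆ p.2

/-- An orientation of the set `S` of finite-order separations: a subset of `S⃗` containing
exactly one of `(A,B)`, `(B,A)` for every finite-order separation `{A,B}`. -/
def IsOrientation (G : SimpleGraph V) (O : Set (Set V × Set V)) : Prop :=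
  O ⊆ Svec G ∧ ∀ A B : Set V, IsFinSep G A B → ((A, B) ∈ O ↔ (B, A) ∉ O)

/-- Consistency: no two distinct members `(B,A)`, `(C,D)` with `(A,B) < (C,D)`. -/
def Consistent (O : Set (Set V × Set V)) : Prop :=
  ∀ A B C D : Set V, (B, A) ∈ O → (C, D) ∈ O → (B, A) ≠ (C, D) →
    ¬ (sepLE (A, B) (C, D) ∧ (A, B) ≠ (C, D))

/-- A star in `S⃗`: every two distinct elements point towards each other. -/
def IsStar (G : SimpleGraph V) (σ : Set (Set V × Set V)) : Prop :=
  σ ⊆ Svec G ∧ ∀ p ∈ σ, ∀ q ∈ σ, p ≠ q → sepLE p (q.2, q.1)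

/-- Membership in `T_n`: a star of at most `n` elements whose target sides have finite
intersection. -/
def InTn (G : SimpleGraph V) (n : ℕ) (σ : Set (Set V × Set V)) : Prop :=
  IsStar G σ ∧ σ.Finite ∧ σ.ncard ≤ n ∧ (⋂ p ∈ σ, p.2).Finite

/-- Membership in `T`: an arbitrary star whose target sides have finite intersection. -/
def InT (G : SimpleGraph V) (σ : Set (Set V × Set V)) : Prop :=
  IsStar G σ ∧ (⋂ p ∈ σ, p.2).Finite

/-- An `ℵ₀`-tangle of `G`: a consistent orientation of `S` with no subset in `T₃`. -/
def IsTangle (G : SimpleGraph V) (τ : Set (Set V × Set V)) : Prop :=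
  IsOrientation G τ ∧ Consistent τ ∧ ∀ σ ⊆ τ, ¬ InTn G 3 σ

/-- A `T`-tangle of `S`: a consistent orientation of `S` with no subset in `T`. -/
def IsTTangle (G : SimpleGraph V) (τ : Set (Set V × Set V)) : Prop :=
  IsOrientation G τ ∧ Consistent τ ∧ ∀ σ ⊆ τ, ¬ InT G σ

/-- The set `𝒞_X` of (vertex sets of) connected components of `G − X`. -/
def Comps (G : SimpleGraph V) (X : Set V) : Set (Set V) :=
  {C | ∃ c : (G.induce Xᶜ).ConnectedComponent, C = Subtype.val '' c.supp}

/-- A collection of subsets of `α` is an ultrafilter on `α`. -/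
def IsUltra {α : Type*} (F : Set (Set α)) : Prop :=
  ∅ ∉ F ∧ (∀ s ∈ F, ∀ t ∈ F, s ∩ t ∈ F) ∧ (∀ s ∈ F, ∀ t : Set α, s ⊆ t → t ∈ F) ∧
    ∀ s : Set α, s ∈ F ∨ sᶜ ∈ F

/-- A principal ultrafilter, generated by a single point. -/
def IsPrincipalUF {α : Type*} (F : Set (Set α)) : Prop :=
  ∃ a : α, F = {s | a ∈ s}

/-- `U(τ,X)`: the collection of all sets `𝒮` of components of `G − X` with
`(⋃(𝒞_X∖𝒮) ∪ X, ⋃𝒮 ∪ X) ∈ τ`. -/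
def tangleUF (G : SimpleGraph V) (τ : Set (Set V × Set V)) (X : Set V) :
    Set (Set ↥(Comps G X)) :=
  {𝒮 | ((⋃ C ∈ 𝒮ᶜ, (C : Set V)) ∪ X, (⋃ C ∈ 𝒮, (C : Set V)) ∪ X) ∈ τ}

/-- `f_{X',X}`: the pushforward of an ultrafilter on `𝒞_{X'}` along the map sending each
component of `G − X'` to the component of `G − X` containing it. -/
def pushUF (G : SimpleGraph V) (X X' : Set V) (F : Set (Set ↥(Comps G X'))) :
    Set (Set ↥(Comps G X)) :=
  {𝒮 | {C' : ↥(Comps G X') | ∃ C ∈ 𝒮, (C' : Set V) ⊆ (C : Set V)} ∈ F}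

/-- A direction in `G`: a choice of a component of `G − X` for every finite `X ⊆ V`,
compatible under inclusion. -/
def IsDirection (G : SimpleGraph V) (f : Set V → Set V) : Prop :=
  (∀ X : Set V, X.Finite → f X ∈ Comps G X) ∧
    ∀ X X' : Set V, X.Finite → X'.Finite → X ⊆ X' → f X' ⊆ f X

namespace IsFinSep

variable {G : SimpleGraph V} {A B C D : Set V}

lemma mem_or_mem (h : IsFinSep G A B) (v : V) : v ∈ A ∨ v ∈ B := by
  have : v ∈ A ∪ B := h.1.1 ▸ Set.mem_univ v
  exact this

lemma symm (h : IsFinSep G A B) : IsFinSep G B A :=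
  ⟨⟨by rw [Set.union_comm]; exact h.1.1, fun a ha b hb hab => h.1.2 b hb a ha hab.symm⟩,
    by rw [Set.inter_comm]; exact h.2⟩

lemma sup (h : IsFinSep G A B) (h' : IsFinSep G C D) : IsFinSep G (A ∪ C) (B ∩ D) := by
  refine ⟨⟨?_, ?_⟩, (h.2.union h'.2).subset ?_⟩
  · ext v
    have := h.mem_or_mem v
    have := h'.mem_or_mem v
    simp only [Set.mem_union, Set.mem_inter_iff, Set.mem_univ, iff_true]
    tauto
  · rintro a ⟨-, ha⟩ b ⟨⟨hbB, hbD⟩, hb⟩ hab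
    have hbA : b ∉ A := fun h => hb (Or.inl h)
    have hbC : b ∉ C := fun h => hb (Or.inr h)
    by_cases haB : a ∈ B
    · have haD : a ∉ D := fun h => ha ⟨haB, h⟩
      exact h'.1.2 a ⟨(h'.mem_or_mem a).resolve_right haD, haD⟩ b ⟨hbD, hbC⟩ hab
    · exact h.1.2 a ⟨(h.mem_or_mem a).resolve_right haB, haB⟩ b ⟨hbB, hbA⟩ hab
  · rintro v ⟨hA | hC, hB, hD⟩
    · exact Or.inl ⟨hA, hB⟩
    · exact Or.inr ⟨hC, hD⟩

lemma inf (h : IsFinSep G A B) (h' : IsFinSep G C D) : IsFinSep G (A ∩ C) (B ∪ D) :=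
  (h.symm.sup h'.symm).symm

end IsFinSep

namespace IsTangle

variable {G : SimpleGraph V} {τ : Set (Set V × Set V)} {A B C D E F : Set V}

lemma isFinSep (hτ : IsTangle G τ) (h : (A, B) ∈ τ) : IsFinSep G A B := hτ.1.1 h

lemma mem_or_mem (hτ : IsTangle G τ) (h : IsFinSep G A B) : (A, B) ∈ τ ∨ (B, A) ∈ τ := by
  have := hτ.1.2 A B h
  tauto

lemma infinite_right (hτ : IsTangle G τ) (h : (A, B) ∈ τ) : B.Infinite := by
  intro hB
  refine hτ.2.2 {(A, B)} (by simpa using h) ⟨⟨?_, ?_⟩, ?_, ?_, ?_⟩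
  · simpa using hτ.1.1 h
  · simp
  · simp
  · simp
  · simpa using hB

/-- Tangles are closed downwards in the order on separations. -/
lemma mem_of_le (hτ : IsTangle G τ) (h : (C, D) ∈ τ) (hAB : IsFinSep G A B)
    (hAC : A ⊆ C) (hDB : D ⊆ B) : (A, B) ∈ τ := by
  by_contra hn
  have hBA := (hτ.mem_or_mem hAB).resolve_left hn
  refine hτ.2.1 A B C D hBA h ?_ ⟨⟨hAC, hDB⟩, fun he => hn (he ▸ h)⟩
  intro he
  obtain ⟨rfl, rfl⟩ := Prod.mk.inj he
  exact hτ.infinite_right h (hAB.2.subset fun v hv => ⟨hv, hAC hv⟩)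

lemma infinite_inter_inter (hτ : IsTangle G τ) (h₁ : (A, B) ∈ τ) (h₂ : (C, D) ∈ τ)
    (h₃ : (E, F) ∈ τ) : (B ∩ D ∩ F).Infinite := by
  intro hfin
  have s₁ := hτ.isFinSep h₁
  have s₂ := hτ.isFinSep h₂
  have s₃ := hτ.isFinSep h₃
  have k₂ : (C ∩ B, D ∪ A) ∈ τ :=
    hτ.mem_of_le h₂ (s₂.inf s₁.symm) Set.inter_subset_left Set.subset_union_left
  have k₃ : (E ∩ (B ∩ D), F ∪ (A ∪ C)) ∈ τ :=
    hτ.mem_of_le h₃ (s₃.inf (s₁.sup s₂).symm) Set.inter_subset_left Set.subset_union_left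
  have hsub : {(A, B), (C ∩ B, D ∪ A), (E ∩ (B ∩ D), F ∪ (A ∪ C))} ⊆ τ := by
    rintro p (rfl | rfl | rfl) <;> assumption
  refine hτ.2.2 _ hsub ⟨⟨hsub.trans hτ.1.1, ?_⟩, by simp, ?_, ?_⟩
  · rintro p (rfl | rfl | rfl) q (rfl | rfl | rfl) hpq <;>
      first
      | exact absurd rfl hpq
      | (constructor <;> intro v hv <;> simp only [Set.mem_union, Set.mem_inter_iff] at hv ⊢ <;>
          tauto)
  · refine (Set.ncard_insert_le _ _).trans (Nat.succ_le_succ ?_)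
    exact (Set.ncard_insert_le _ _).trans (by simp)
  · refine (hfin.union (s₁.2.union s₂.2)).subset fun v hv => ?_
    simp only [Set.mem_insert_iff, Set.mem_singleton_iff, Set.iInter_iInter_eq_or_left,
      Set.iInter_iInter_eq_left, Set.mem_union, Set.mem_inter_iff] at hv ⊢
    tauto

lemma infinite_inter (hτ : IsTangle G τ) (h₁ : (A, B) ∈ τ) (h₂ : (C, D) ∈ τ) :
    (B ∩ D).Infinite := by
  simpa [Set.inter_assoc] using hτ.infinite_inter_inter h₁ h₂ h₂

/-- Tangles are closed under suprema of separations. -/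
lemma sup_mem (hτ : IsTangle G τ) (h₁ : (A, B) ∈ τ) (h₂ : (C, D) ∈ τ) :
    (A ∪ C, B ∩ D) ∈ τ := by
  have hs := (hτ.isFinSep h₁).sup (hτ.isFinSep h₂)
  refine (hτ.mem_or_mem hs).resolve_right fun hn => ?_
  refine hτ.infinite_inter_inter h₁ h₂ hn ?_
  rw [Set.inter_comm]
  exact hs.2

end IsTangle

section Components

variable {G : SimpleGraph V} {X : Set V} {C D : Set V} {u v : V}

lemma exists_mem_comps (hv : v ∉ X) : ∃ C ∈ Comps G X, v ∈ C :=
  ⟨_, ⟨(G.induce Xᶜ).connectedComponentMk ⟨v, hv⟩, rfl⟩, ⟨v, hv⟩, rfl, rfl⟩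

lemma notMem_of_mem_comps (hC : C ∈ Comps G X) (hv : v ∈ C) : v ∉ X := by
  obtain ⟨c, rfl⟩ := hC
  obtain ⟨w, -, rfl⟩ := hv
  exact w.2

lemma comps_eq_of_mem (hC : C ∈ Comps G X) (hD : D ∈ Comps G X) (hvC : v ∈ C) (hvD : v ∈ D) :
    C = D := by
  obtain ⟨c, rfl⟩ := hC
  obtain ⟨d, rfl⟩ := hD
  obtain ⟨w, hw, rfl⟩ := hvC
  obtain ⟨w', hw', he⟩ := hvD
  obtain rfl := Subtype.ext he
  rw [SimpleGraph.ConnectedComponent.mem_supp_iff] at hw hw'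
  rw [← hw, ← hw']

lemma comps_eq_of_adj (hC : C ∈ Comps G X) (hD : D ∈ Comps G X) (hu : u ∈ C) (hv : v ∈ D)
    (huv : G.Adj u v) : C = D := by
  obtain ⟨c, rfl⟩ := hC
  obtain ⟨d, rfl⟩ := hD
  obtain ⟨w, hw, rfl⟩ := hu
  obtain ⟨w', hw', rfl⟩ := hv
  rw [SimpleGraph.ConnectedComponent.mem_supp_iff] at hw hw'
  have : (G.induce Xᶜ).Adj w w' := huv
  rw [← hw, ← hw', SimpleGraph.ConnectedComponent.sound this.reachable]

/-- A component avoiding the separator lies on one side of the separation. -/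
lemma comps_subset_or_subset {A B : Set V} (hC : C ∈ Comps G X) (h : IsFinSep G A B)
    (hd : Disjoint C (A ∩ B)) : C ⊆ A ∨ C ⊆ B := by
  by_contra! hn
  obtain ⟨⟨u, hu, huA⟩, ⟨v, hv, hvB⟩⟩ := And.imp Set.not_subset.1 Set.not_subset.1 hn
  obtain ⟨c, rfl⟩ := hC
  have huB := (h.mem_or_mem u).resolve_left huA
  obtain ⟨u, hu, rfl⟩ := hu
  obtain ⟨v, hv, rfl⟩ := hv
  rw [SimpleGraph.ConnectedComponent.mem_supp_iff] at hu hv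
  obtain ⟨w⟩ := SimpleGraph.ConnectedComponent.exact (hu.trans hv.symm)
  clear hn huA
  induction w with
  | nil => exact hvB huB
  | @cons x y z hxy w ih =>
    have hy : (G.induce Xᶜ).connectedComponentMk y = c := by
      rw [← hu]
      exact (SimpleGraph.ConnectedComponent.sound hxy.reachable).symm
    have hxA : (x : V) ∉ A := fun hA => Set.disjoint_left.1 hd ⟨x, hu, rfl⟩ ⟨hA, huB⟩
    refine ih hy ?_ hv hvB
    by_contra hyB
    exact h.1.2 y ⟨(h.mem_or_mem _).resolve_right hyB, hyB⟩ x ⟨huB, hxA⟩ hxy.symm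

/-- Only finitely many components meet a given finite set. -/
lemma finite_comps_meeting {Y : Set V} (hY : Y.Finite) :
    {C : Comps G X | ¬ Disjoint (C : Set V) Y}.Finite := by
  have h : ∀ C : {C : Comps G X | ¬ Disjoint (C : Set V) Y}, ∃ y : Y, (y : V) ∈ (C.1 : Set V) := by
    rintro ⟨C, hC⟩
    obtain ⟨y, hyC, hyY⟩ := Set.not_disjoint_iff.1 hC
    exact ⟨⟨y, hyY⟩, hyC⟩
  choose f hf using h
  have := hY.to_subtype
  refine Set.finite_coe_iff.1 (Finite.of_injective f fun C D he => ?_)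
  refine Subtype.ext (Subtype.ext (comps_eq_of_mem C.1.2 D.1.2 (hf C) ?_))
  rw [he]
  exact hf D

lemma isFinSep_iUnion_comps (hX : X.Finite) (𝒮 : Set (Comps G X)) :
    IsFinSep G ((⋃ C ∈ 𝒮ᶜ, (C : Set V)) ∪ X) ((⋃ C ∈ 𝒮, (C : Set V)) ∪ X) := by
  refine ⟨⟨?_, ?_⟩, hX.subset ?_⟩
  · refine Set.eq_univ_of_forall fun v => ?_
    by_cases hv : v ∈ X
    · exact Or.inl (Or.inr hv)
    · obtain ⟨C, hC, hvC⟩ := exists_mem_comps (G := G) hv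
      by_cases hS : (⟨C, hC⟩ : Comps G X) ∈ 𝒮
      · exact Or.inr (Or.inl (Set.mem_biUnion hS hvC))
      · exact Or.inl (Or.inl (Set.mem_biUnion (s := 𝒮ᶜ) hS hvC))
  · rintro a ⟨ha | ha, ha'⟩ b ⟨hb | hb, hb'⟩ hab
    · obtain ⟨C, hCS, haC⟩ := Set.mem_iUnion₂.1 ha
      obtain ⟨D, hDS, hbD⟩ := Set.mem_iUnion₂.1 hb
      exact hCS (Subtype.ext (comps_eq_of_adj C.2 D.2 haC hbD hab) ▸ hDS)
    · exact hb' (Or.inr hb)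
    · exact ha' (Or.inr ha)
    · exact ha' (Or.inr ha)
  · rintro v ⟨ha | ha, hb | hb⟩
    · obtain ⟨C, hCS, haC⟩ := Set.mem_iUnion₂.1 ha
      obtain ⟨D, hDS, hbD⟩ := Set.mem_iUnion₂.1 hb
      exact absurd (Subtype.ext (comps_eq_of_mem C.2 D.2 haC hbD) ▸ hDS) hCS
    · exact hb
    · exact ha
    · exact ha

end Components

namespace IsTangle

variable {G : SimpleGraph V} {τ : Set (Set V × Set V)} {X : Set V} {𝒮 𝒯 : Set (Comps G X)}

/-- A separation whose target side contains the components of a large set belongs to the tangle. -/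
lemma mem_of_iUnion_subset (hτ : IsTangle G τ) (hX : X.Finite) (h𝒮 : 𝒮 ∈ tangleUF G τ X)
    {A B : Set V} (h : IsFinSep G A B) (hB : (⋃ C ∈ 𝒮, (C : Set V)) ⊆ B) : (A, B) ∈ τ := by
  refine (hτ.mem_or_mem h).resolve_right fun hn => hτ.infinite_inter h𝒮 hn ?_
  refine (h.2.union hX).subset ?_
  rintro v ⟨hv | hv, hA⟩
  · exact Or.inl ⟨hA, hB hv⟩
  · exact Or.inr hv

lemma tangleUF_mono (hτ : IsTangle G τ) (hX : X.Finite) (h𝒮 : 𝒮 ∈ tangleUF G τ X)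
    (h : 𝒮 ⊆ 𝒯) : 𝒯 ∈ tangleUF G τ X :=
  hτ.mem_of_iUnion_subset hX h𝒮 (isFinSep_iUnion_comps hX 𝒯)
    ((Set.biUnion_subset_biUnion_left h).trans Set.subset_union_left)

lemma tangleUF_inter (hτ : IsTangle G τ) (hX : X.Finite) (h𝒮 : 𝒮 ∈ tangleUF G τ X)
    (h𝒯 : 𝒯 ∈ tangleUF G τ X) : 𝒮 ∩ 𝒯 ∈ tangleUF G τ X := by
  refine hτ.mem_of_le (hτ.sup_mem h𝒮 h𝒯) (isFinSep_iUnion_comps hX _) ?_ ?_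
  · rintro v (hv | hv)
    · obtain ⟨C, hC, hvC⟩ := Set.mem_iUnion₂.1 hv
      rw [Set.compl_inter] at hC
      rcases hC with hC | hC
      · exact Or.inl (Or.inl (Set.mem_biUnion hC hvC))
      · exact Or.inr (Or.inl (Set.mem_biUnion hC hvC))
    · exact Or.inl (Or.inr hv)
  · rintro v ⟨hv | hv, hv' | hv'⟩
    · obtain ⟨C, hC, hvC⟩ := Set.mem_iUnion₂.1 hv
      obtain ⟨D, hD, hvD⟩ := Set.mem_iUnion₂.1 hv'
      obtain rfl := Subtype.ext (comps_eq_of_mem C.2 D.2 hvC hvD)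
      exact Or.inl (Set.mem_biUnion (s := 𝒮 ∩ 𝒯) ⟨hC, hD⟩ hvC)
    all_goals exact Or.inr (by assumption)

lemma compl_mem_tangleUF_iff (hτ : IsTangle G τ) (hX : X.Finite) :
    𝒮ᶜ ∈ tangleUF G τ X ↔ 𝒮 ∉ tangleUF G τ X := by
  have := hτ.1.2 _ _ (isFinSep_iUnion_comps hX 𝒮ᶜ)
  rw [compl_compl] at this
  simpa only [tangleUF, Set.mem_ofPred_eq, compl_compl] using this

/-- `U(τ,X)` as an ultrafilter. -/
def ultrafilter (hτ : IsTangle G τ) (hX : X.Finite) : Ultrafilter (Comps G X) :=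
  Ultrafilter.ofComplNotMemIff
    { sets := tangleUF G τ X
      univ_sets := by
        by_contra hn
        have h := (hτ.compl_mem_tangleUF_iff hX).2 hn
        exact hn (hτ.tangleUF_mono hX h (Set.subset_univ _))
      sets_of_superset := fun h h' => hτ.tangleUF_mono hX h h'
      inter_sets := fun h h' => hτ.tangleUF_inter hX h h' }
    fun s => by
      change sᶜ ∉ tangleUF G τ X ↔ s ∈ tangleUF G τ X
      rw [hτ.compl_mem_tangleUF_iff hX, not_not]

lemma mem_ultrafilter (hτ : IsTangle G τ) (hX : X.Finite) :
    𝒮 ∈ hτ.ultrafilter hX ↔ 𝒮 ∈ tangleUF G τ X := Iff.rfl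

lemma notMem_tangleUF_of_finite (hτ : IsTangle G τ) (hX : X.Finite)
    (hnp : ¬ IsPrincipalUF (tangleUF G τ X)) (hfin : 𝒮.Finite) : 𝒮 ∉ tangleUF G τ X := by
  intro h
  obtain ⟨C, -, hC⟩ :=
    Ultrafilter.eq_pure_of_finite_mem hfin ((hτ.mem_ultrafilter hX).2 h)
  refine hnp ⟨C, Set.ext fun 𝒯 => ?_⟩
  rw [← hτ.mem_ultrafilter hX, hC]
  exact Ultrafilter.mem_pure

end IsTangle

/-- Lemma 3.4: if `U(τ,X)` is non-principal, then
`τ = {(A',B') ∈ S⃗ : ∃ 𝒞 ∈ U(τ,X), ⋃𝒞 ⊆ B'}`. -/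
theorem stmt13 [Infinite V] (G : SimpleGraph V) (τ : Set (Set V × Set V))
    (hτ : IsTangle G τ) (X : Set V) (hX : X.Finite)
    (hnp : ¬ IsPrincipalUF (tangleUF G τ X)) :
    τ = {p : Set V × Set V | p ∈ Svec G ∧
      ∃ 𝒮 ∈ tangleUF G τ X, (⋃ C ∈ 𝒮, (C : Set V)) ⊆ p.2} := by
  ext ⟨A, B⟩
  constructor
  · intro h
    have hs := hτ.isFinSep h
    refine ⟨hs, {C : Comps G X | (C : Set V) ⊆ B}, ?_, Set.iUnion₂_subset fun C hC => hC⟩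
    by_contra hn
    have hcompl := (hτ.compl_mem_tangleUF_iff hX).2 hn
    have hcofin := (hτ.compl_mem_tangleUF_iff hX).2
      (hτ.notMem_tangleUF_of_finite hX hnp (finite_comps_meeting (G := G) (X := X) hs.2))
    have hBA : (B, A) ∈ τ := by
      refine hτ.mem_of_iUnion_subset hX (hτ.tangleUF_inter hX hcompl hcofin) hs.symm ?_
      refine Set.iUnion₂_subset fun C hC => ?_
      exact (comps_subset_or_subset C.2 hs (not_not.1 hC.2)).resolve_right hC.1
    exact (hτ.1.2 A B hs).1 h hBA
  · rintro ⟨hs, 𝒮, h𝒮, hB⟩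
    exact hτ.mem_of_iUnion_subset hX h𝒮 hs hB
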